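/- Let P ⊆ B(n) be an intersecting family and let A = {ID(p) : p ∈ min(P)}. Then P has maximum size among intersecting families in B(n) (equivalently, |P| = n!/2) if and only if A is a maximal intersecting antichain and P = P(A). -/

import Mathlib

/-- The inversion set of a permutation `p` of `{0,…,n-1}` (0-indexed version of
`Inv(p) = {(p_j, p_i) : i < j, p_j < p_i}`): pairs `(a, b)` of values with `a < b`
such that `b` precedes `a` in the one-line notation of `p`. -/
def InvSet (n : ℕ) (p : Equiv.Perm (Fin n)) : Finset (Fin n × Fin n) :=
  Finset.univ.filter (fun x => x.1 < x.2 ∧ p.symm x.2 < p.symm x.1)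

/-- The weak (right) Bruhat order: `p ≼ q` iff `Inv(p) ⊆ Inv(q)`. -/
def BLE {n : ℕ} (p q : Equiv.Perm (Fin n)) : Prop :=
  InvSet n p ⊆ InvSet n q

/-- The rank of a permutation in the weak Bruhat order: `rank(p) = |Inv(p)|`. -/
def brank (n : ℕ) (p : Equiv.Perm (Fin n)) : ℕ :=
  (InvSet n p).card

/-- The inverse descent set `ID(p) ⊆ {1,…,n-1}`: `i ∈ ID(p)` iff the (1-indexed)
value `i+1` precedes the value `i` in the one-line notation of `p`.  Here the
1-indexed value `v ∈ {1,…,n}` corresponds to the element of `Fin n` with `val = v - 1`. -/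
def ID (n : ℕ) (p : Equiv.Perm (Fin n)) : Finset ℕ :=
  (Finset.Icc 1 (n - 1)).filter
    (fun i => ∃ a b : Fin n, (a : ℕ) + 1 = i ∧ (b : ℕ) = i ∧ p.symm b < p.symm a)

/-- The generator `g i` is the adjacent transposition interchanging the
(1-indexed) values `i` and `i+1`. -/
def g (n i : ℕ) : Equiv.Perm (Fin n) :=
  if h : 1 ≤ i ∧ i < n then Equiv.swap ⟨i - 1, by omega⟩ ⟨i, h.2⟩ else 1

/-- A family of permutations is intersecting if any two of its members have
meet different from the identity in the weak Bruhat lattice; equivalently (since the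
identity is the minimum), any two members have a common lower bound distinct
from the identity. -/
def BInter (n : ℕ) (P : Set (Equiv.Perm (Fin n))) : Prop :=
  ∀ p ∈ P, ∀ q ∈ P, ∃ r : Equiv.Perm (Fin n), r ≠ 1 ∧ BLE r p ∧ BLE r q

/-- A maximal intersecting family: intersecting, and every permutation
intersecting all its members belongs to it. -/
def MaxBInter (n : ℕ) (P : Set (Equiv.Perm (Fin n))) : Prop :=
  BInter n P ∧ ∀ q : Equiv.Perm (Fin n),
    (∀ p ∈ P, ∃ r : Equiv.Perm (Fin n), r ≠ 1 ∧ BLE r q ∧ BLE r p) → q ∈ P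

/-- The set of `≼`-minimal elements of a family `P`. -/
def minSet (n : ℕ) (P : Set (Equiv.Perm (Fin n))) : Set (Equiv.Perm (Fin n)) :=
  {p | p ∈ P ∧ ∀ q ∈ P, BLE q p → q = p}

/-- `m` is the meet (greatest lower bound) of `p` and `q` in the weak Bruhat order. -/
def IsMeetB (n : ℕ) (p q m : Equiv.Perm (Fin n)) : Prop :=
  BLE m p ∧ BLE m q ∧ ∀ r, BLE r p → BLE r q → BLE r m

/-- `m` is the join (least upper bound) of the set `S` in the weak Bruhat order. -/
def IsLUBB (n : ℕ) (S : Set (Equiv.Perm (Fin n))) (m : Equiv.Perm (Fin n)) : Prop :=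
  (∀ s ∈ S, BLE s m) ∧ ∀ u, (∀ s ∈ S, BLE s u) → BLE m u

/-- For a system `𝒜` of subsets of `{1,…,n-1}`,
`P(𝒜) = {p : A ⊆ ID(p) for some A ∈ 𝒜}`. -/
def PofSystem (n : ℕ) (𝒜 : Set (Finset ℕ)) : Set (Equiv.Perm (Fin n)) :=
  {p | ∃ A ∈ 𝒜, A ⊆ ID n p}

/-- The generating set system of a family `P`: `{ID(p) : p ∈ min(P)}`. -/
def genSys (n : ℕ) (P : Set (Equiv.Perm (Fin n))) : Set (Finset ℕ) :=
  {A | ∃ p ∈ minSet n P, ID n p = A}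

/-- A maximal intersecting antichain of subsets of `{1,…,n-1}`: an antichain
under inclusion, any two members of which meet, such that for every subset `B`
of `{1,…,n-1}` not in the system there is a member `A` with `A ∩ B = ∅` or `A ⊆ B`. -/
def MIA (n : ℕ) (𝒜 : Set (Finset ℕ)) : Prop :=
  (∀ A ∈ 𝒜, ∀ B ∈ 𝒜, A ⊆ B → A = B) ∧
  (∀ A ∈ 𝒜, ∀ B ∈ 𝒜, (A ∩ B).Nonempty) ∧
  (∀ B : Finset ℕ, B ⊆ Finset.Icc 1 (n - 1) → B ∉ 𝒜 → ∃ A ∈ 𝒜, A ∩ B = ∅ ∨ A ⊆ B)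

theorem mem_InvSet {n : ℕ} {p : Equiv.Perm (Fin n)} {a b : Fin n} :
    (a, b) ∈ InvSet n p ↔ a < b ∧ p.symm b < p.symm a := by
  simp [InvSet]

theorem mem_ID_iff {n i : ℕ} (p : Equiv.Perm (Fin n)) (h0 : 1 ≤ i) (hi : i < n) :
    i ∈ ID n p ↔ p.symm ⟨i, hi⟩ < p.symm ⟨i - 1, by omega⟩ := by
  unfold ID
  rw [Finset.mem_filter, Finset.mem_Icc]
  constructor
  · rintro ⟨-, a, b, ha, hb, hlt⟩
    have h1 : a = ⟨i - 1, by omega⟩ := Fin.ext (by simp; omega)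
    have h2 : b = ⟨i, hi⟩ := Fin.ext hb
    rwa [← h1, ← h2]
  · intro h
    exact ⟨by omega, _, _, by simp; omega, rfl, h⟩

theorem ID_subset_Icc (n : ℕ) (p : Equiv.Perm (Fin n)) : ID n p ⊆ Finset.Icc 1 (n - 1) :=
  Finset.filter_subset _ _

theorem ID_mono {n : ℕ} {p q : Equiv.Perm (Fin n)} (h : BLE p q) : ID n p ⊆ ID n q := by
  intro i hi
  have hI := Finset.mem_Icc.1 (ID_subset_Icc n p hi)
  rw [mem_ID_iff _ hI.1 (by omega)] at hi ⊢
  exact (mem_InvSet.1 (h (mem_InvSet.2 ⟨by simp [Fin.lt_def]; omega, hi⟩))).2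

/-- A transitive relation holding between consecutive elements of an interval of `Fin n`
holds between its endpoints. -/
theorem rel_of_consecutive {n : ℕ} (R : Fin n → Fin n → Prop)
    (hR : ∀ x y z, R x y → R y z → R x z) {a b : Fin n} (hab : a < b)
    (h : ∀ i (hi : i < n), (a : ℕ) < i → i ≤ b → R ⟨i - 1, by omega⟩ ⟨i, hi⟩) : R a b := by
  have key : ∀ k (hk : k < n), (a : ℕ) < k → k ≤ b → R a ⟨k, hk⟩ := by
    intro k
    induction k with
    | zero => intro _ h; omega
    | succ k ih =>
      intro hk hak hkb
      have hs := h (k + 1) hk hak hkb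
      rcases Nat.lt_or_ge a k with hlt | hge
      · exact hR _ _ _ (ih (by omega) hlt (by omega)) hs
      · have : a = ⟨k + 1 - 1, by omega⟩ := Fin.ext (by simp; omega)
        rwa [← this] at hs
  exact key b b.2 hab le_rfl

theorem BLE_antisymm {n : ℕ} {p q : Equiv.Perm (Fin n)} (h₁ : BLE p q) (h₂ : BLE q p) :
    p = q := by
  have hlt : ∀ {x y : Fin n}, x < y → p.symm x < p.symm y → q.symm x < q.symm y := by
    intro x y hxy hp
    by_contra hq
    have hne : q.symm y ≠ q.symm x := fun e => hxy.ne' (q.symm.injective e)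
    have := (mem_InvSet.1 (h₂ (mem_InvSet.2 ⟨hxy, lt_of_le_of_ne (not_lt.1 hq) hne⟩))).2
    exact lt_asymm hp this
  have hmono : StrictMono (fun i => q.symm (p i)) := by
    intro i j hij
    rcases lt_trichotomy (p i) (p j) with h | h | h
    · exact hlt h (by simpa using hij)
    · exact absurd (p.injective h) hij.ne
    · exact (mem_InvSet.1 (h₁ (mem_InvSet.2 ⟨h, by simpa using hij⟩))).2
  have hid : (fun i => q.symm (p i)) = id := by
    have e := Subsingleton.elim
      (hmono.orderIsoOfSurjective _ (q.symm.surjective.comp p.surjective)) (OrderIso.refl _)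
    funext i
    exact congrArg (fun f : Fin n ≃o Fin n => f i) e
  ext i : 1
  have := congrFun hid i
  simp only [id] at this
  exact (Equiv.symm_apply_eq q).1 this

theorem ID_nonempty {n : ℕ} {r : Equiv.Perm (Fin n)} (hr : r ≠ 1) : (ID n r).Nonempty := by
  by_contra hne
  rw [Finset.not_nonempty_iff_eq_empty] at hne
  apply hr
  have hempty : InvSet n r ⊆ ∅ := by
    rintro ⟨a, b⟩ hab
    obtain ⟨hlt, hinv⟩ := mem_InvSet.1 hab
    have := rel_of_consecutive (fun x y => r.symm x < r.symm y)
      (fun _ _ _ => lt_trans) hlt (by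
        intro i hi hai _
        by_contra hcon
        have hmem : i ∈ ID n r := by
          rw [mem_ID_iff r (by omega) hi]
          refine lt_of_le_of_ne (not_lt.1 hcon) fun e => ?_
          have := congrArg Fin.val (r.symm.injective e)
          simp at this
          omega
        simp [hne] at hmem)
    exact absurd hinv this.asymm
  refine BLE_antisymm (hempty.trans (Finset.empty_subset _)) ?_
  rintro ⟨a, b⟩ hab
  obtain ⟨h₁, h₂⟩ := mem_InvSet.1 hab
  exact absurd h₁ (lt_asymm h₂)

/-- The number of elements of `{1,…,v}` outside `A`. -/
def gapCount (A : Finset ℕ) (v : ℕ) : ℕ := (Finset.Icc 1 v \ A).card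

theorem gapCount_mono (A : Finset ℕ) : Monotone (gapCount A) := fun _ _ h =>
  Finset.card_le_card (Finset.sdiff_subset_sdiff (Finset.Icc_subset_Icc le_rfl h) le_rfl)

theorem mem_of_gapCount_le {A : Finset ℕ} {v w i : ℕ} (h : gapCount A w ≤ gapCount A v)
    (hv : v < i) (hw : i ≤ w) : i ∈ A := by
  by_contra hi
  refine absurd h (not_le.2 (Finset.card_lt_card (Finset.ssubset_iff_subset_ne.2 ⟨?_, ?_⟩)))
  · exact Finset.sdiff_subset_sdiff (Finset.Icc_subset_Icc le_rfl (by omega)) le_rfl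
  · intro e
    have : i ∈ Finset.Icc 1 w \ A := by simp [hi]; omega
    rw [← e] at this
    simp at this
    omega

theorem gapCount_pred {A : Finset ℕ} {i : ℕ} (hi : i ∈ A) :
    gapCount A i = gapCount A (i - 1) := by
  unfold gapCount
  congr 1
  ext j
  simp only [Finset.mem_sdiff, Finset.mem_Icc]
  constructor
  · rintro ⟨h, hj⟩
    have : j ≠ i := fun e => hj (e ▸ hi)
    exact ⟨by omega, hj⟩
  · rintro ⟨h, hj⟩
    exact ⟨by omega, hj⟩

/-- The join of the adjacent transpositions indexed by `A` exists: it has inverse descent set `A`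
and lies below every permutation whose inverse descent set contains `A`. -/
theorem exists_least_of_ID {n : ℕ} {A : Finset ℕ} (hA : A ⊆ Finset.Icc 1 (n - 1)) :
    ∃ w : Equiv.Perm (Fin n), ID n w = A ∧ ∀ p, A ⊆ ID n p → BLE w p := by
  let key : Fin n → ℕ := fun v => gapCount A v * n + (n - 1 - v)
  have hkey : ∀ a b : Fin n, a < b → (key b < key a ↔ gapCount A b ≤ gapCount A a) := by
    intro a b hab
    have hb := b.2
    have hab' : (a : ℕ) < b := hab
    constructor
    · intro h
      by_contra! hc
      have := Nat.mul_le_mul_right n (Nat.succ_le_of_lt hc)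
      simp only [Nat.succ_mul, key] at *
      omega
    · intro h
      have := Nat.mul_le_mul_right n h
      simp only [key]
      omega
  have hinj : Function.Injective key := by
    have hne : ∀ a b : Fin n, a < b → key a ≠ key b := by
      intro a b hab e
      have h := gapCount_mono A hab.le
      rcases h.lt_or_eq with h | h
      · have hab' : (a : ℕ) < b := hab
        have := Nat.mul_le_mul_right n (Nat.succ_le_of_lt h)
        simp only [Nat.succ_mul, key] at *
        omega
      · exact absurd ((hkey a b hab).2 h.ge) (by omega)
    intro a b e
    by_contra hc
    rcases lt_or_gt_of_ne hc with h | h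
    · exact hne _ _ h e
    · exact hne _ _ h e.symm
  let w := Tuple.sort key
  have hmono : StrictMono (key ∘ w) :=
    (Tuple.monotone_sort key).strictMono_of_injective (hinj.comp w.injective)
  have hw : ∀ a b : Fin n, w.symm b < w.symm a ↔ key b < key a := by
    intro a b
    rw [← hmono.lt_iff_lt]
    simp
  refine ⟨w, ?_, ?_⟩
  · ext i
    constructor
    · intro hi
      have hI := Finset.mem_Icc.1 (ID_subset_Icc n w hi)
      rw [mem_ID_iff _ hI.1 (by omega), hw, hkey _ _ (by simp [Fin.lt_def]; omega)] at hi
      exact mem_of_gapCount_le hi (by simp; omega) le_rfl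
    · intro hi
      have hI := Finset.mem_Icc.1 (hA hi)
      rw [mem_ID_iff _ hI.1 (by omega), hw, hkey _ _ (by simp [Fin.lt_def]; omega)]
      exact (gapCount_pred hi).le
  · rintro p hp ⟨a, b⟩ hab
    obtain ⟨hlt, hinv⟩ := mem_InvSet.1 hab
    rw [hw, hkey _ _ hlt] at hinv
    refine mem_InvSet.2 ⟨hlt, rel_of_consecutive (fun x y => p.symm y < p.symm x)
      (fun _ _ _ h₁ h₂ => lt_trans h₂ h₁) hlt ?_⟩
    intro i hi hai hib
    exact (mem_ID_iff p (by omega) hi).1 (hp (mem_of_gapCount_le hinv hai hib))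

/-- Two permutations have a nontrivial common lower bound iff their inverse descent sets meet. -/
theorem exists_common_lower_iff {n : ℕ} (p q : Equiv.Perm (Fin n)) :
    (∃ r : Equiv.Perm (Fin n), r ≠ 1 ∧ BLE r p ∧ BLE r q) ↔ (ID n p ∩ ID n q).Nonempty := by
  constructor
  · rintro ⟨r, hr, hp, hq⟩
    exact (ID_nonempty hr).mono (Finset.subset_inter (ID_mono hp) (ID_mono hq))
  · intro h
    obtain ⟨w, hw, hle⟩ := exists_least_of_ID
      (A := ID n p ∩ ID n q) (Finset.inter_subset_left.trans (ID_subset_Icc n p))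
    refine ⟨w, ?_, hle p Finset.inter_subset_left, hle q Finset.inter_subset_right⟩
    rintro rfl
    rw [← hw] at h
    obtain ⟨i, hi⟩ := h
    have hI := Finset.mem_Icc.1 (ID_subset_Icc n _ hi)
    rw [mem_ID_iff _ hI.1 (by omega)] at hi
    have : i < i - 1 := hi
    omega

/-- Reversing the one-line notation complements the inverse descent set. -/
theorem ID_mul_revPerm {n : ℕ} (p : Equiv.Perm (Fin n)) :
    ID n (p * Fin.revPerm) = Finset.Icc 1 (n - 1) \ ID n p := by
  have hsymm : ∀ x, (p * Fin.revPerm).symm x = Fin.rev (p.symm x) := fun _ => rfl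
  ext i
  rw [Finset.mem_sdiff]
  by_cases hI : i ∈ Finset.Icc 1 (n - 1)
  · have hI' := Finset.mem_Icc.1 hI
    rw [mem_ID_iff _ hI'.1 (by omega), mem_ID_iff _ hI'.1 (by omega), hsymm, hsymm,
      Fin.rev_lt_rev]
    refine ⟨fun h => ⟨hI, h.asymm⟩, fun h => lt_of_le_of_ne (not_lt.1 h.2) fun e => ?_⟩
    have := congrArg Fin.val (p.symm.injective e)
    simp at this
    omega
  · exact ⟨fun h => absurd (ID_subset_Icc n _ h) hI, fun h => absurd h.1 hI⟩

/-- An intersecting family has `n!/2` elements iff it meets every pair consisting of a permutation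
and its reversal. -/
theorem card_eq_half_iff {n : ℕ} (hn : 2 ≤ n) {P : Set (Equiv.Perm (Fin n))}
    (hP : BInter n P) :
    Nat.card P = Nat.factorial n / 2 ↔ ∀ p, p ∈ P ∨ p * Fin.revPerm ∈ P := by
  classical
  let f : Equiv.Perm (Fin n) → Equiv.Perm (Fin n) := fun p => p * Fin.revPerm
  have hf : Function.Injective f := mul_left_injective _
  have hff : ∀ p, f (f p) = p := by
    intro p
    ext x : 1
    simp [f]
  have hsub : f '' P ⊆ Pᶜ := by
    rintro _ ⟨p, hp, rfl⟩ hfp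
    have := (exists_common_lower_iff _ _).1 (hP p hp _ hfp)
    rw [ID_mul_revPerm] at this
    simp at this
  have hcard : P.ncard + Pᶜ.ncard = n.factorial := by
    rw [Set.ncard_add_ncard_compl, Nat.card_perm, Nat.card_fin]
  have himg : (f '' P).ncard = P.ncard := Set.ncard_image_of_injective P hf
  have heven : 2 ∣ n.factorial := Nat.dvd_factorial (by norm_num) hn
  rw [Nat.card_coe_set_eq]
  constructor
  · intro h p
    by_contra! hc
    have heq : f '' P = Pᶜ := Set.eq_of_subset_of_ncard_le hsub (by omega)
    have : p ∈ f '' P := heq ▸ hc.1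
    obtain ⟨q, hq, rfl⟩ := this
    exact hc.2 (by rw [show f q * Fin.revPerm = q from hff q]; exact hq)
  · intro h
    have heq : f '' P = Pᶜ := by
      refine hsub.antisymm fun p hp => ⟨f p, (h p).resolve_left hp, hff p⟩
    rw [heq] at himg
    omega

theorem exists_minSet_BLE {n : ℕ} {P : Set (Equiv.Perm (Fin n))} {p : Equiv.Perm (Fin n)}
    (hp : p ∈ P) : ∃ m ∈ minSet n P, BLE m p := by
  induction hk : brank n p using Nat.strong_induction_on generalizing p with
  | _ k ih =>
    by_cases hmin : p ∈ minSet n P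
    · exact ⟨p, hmin, Finset.Subset.refl _⟩
    · have : ∃ q ∈ P, BLE q p ∧ q ≠ p := by
        by_contra! hc
        exact hmin ⟨hp, hc⟩
      obtain ⟨q, hq, hle, hne⟩ := this
      have hlt : brank n q < k := by
        rw [← hk]
        refine Finset.card_lt_card (Finset.ssubset_iff_subset_ne.2 ⟨hle, fun e => hne ?_⟩)
        exact BLE_antisymm hle (Finset.subset_of_eq e.symm)
      obtain ⟨m, hm, hmq⟩ := ih _ hlt hq rfl
      exact ⟨m, hm, Finset.Subset.trans hmq hle⟩

/-- An intersecting family `P ⊆ B(n)` has maximum size (equivalently, `|P| = n!/2`)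
iff `𝒜 = {ID(p) : p ∈ min(P)}` is a maximal intersecting antichain and `P = P(𝒜)`. -/
theorem stmt_13 (n : ℕ) (hn : 2 ≤ n) (P : Set (Equiv.Perm (Fin n)))
    (hP : BInter n P) :
    Nat.card P = Nat.factorial n / 2 ↔
      (MIA n (genSys n P) ∧ P = PofSystem n (genSys n P)) := by
  rw [card_eq_half_iff hn hP]
  constructor
  · intro hrev
    have hup : ∀ p ∈ P, ∀ q, ID n p ⊆ ID n q → q ∈ P := by
      intro p hp q hpq
      refine (hrev q).resolve_right fun hq => ?_
      obtain ⟨i, hi⟩ := (exists_common_lower_iff _ _).1 (hP p hp _ hq)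
      rw [ID_mul_revPerm, Finset.mem_inter, Finset.mem_sdiff] at hi
      exact hi.2.2 (hpq hi.1)
    refine ⟨⟨?_, ?_, ?_⟩, ?_⟩
    · rintro _ ⟨p, hp, rfl⟩ _ ⟨q, hq, rfl⟩ hpq
      obtain ⟨w, hw, hle⟩ := exists_least_of_ID (ID_subset_Icc n p)
      rw [← hq.2 w (hup p hp.1 w hw.ge) (hle q hpq), hw]
    · rintro _ ⟨p, hp, rfl⟩ _ ⟨q, hq, rfl⟩
      exact (exists_common_lower_iff _ _).1 (hP p hp.1 q hq.1)
    · intro B hB _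
      obtain ⟨w, rfl, -⟩ := exists_least_of_ID hB
      rcases hrev w with hw | hw
      · obtain ⟨m, hm, hle⟩ := exists_minSet_BLE hw
        exact ⟨_, ⟨m, hm, rfl⟩, Or.inr (ID_mono hle)⟩
      · obtain ⟨m, hm, hle⟩ := exists_minSet_BLE hw
        refine ⟨_, ⟨m, hm, rfl⟩, Or.inl ?_⟩
        have := ID_mono hle
        rw [ID_mul_revPerm] at this
        exact Finset.disjoint_iff_inter_eq_empty.1
          (Finset.disjoint_of_subset_left this Finset.sdiff_disjoint)
    · ext p
      constructor
      · intro hp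
        obtain ⟨m, hm, hle⟩ := exists_minSet_BLE hp
        exact ⟨_, ⟨m, hm, rfl⟩, ID_mono hle⟩
      · rintro ⟨_, ⟨m, hm, rfl⟩, hle⟩
        exact hup m hm.1 p hle
  · rintro ⟨⟨-, -, hmax⟩, hPA⟩ p
    by_cases hB : ID n p ∈ genSys n P
    · left
      rw [hPA]
      exact ⟨_, hB, subset_rfl⟩
    · obtain ⟨A, hA, h | h⟩ := hmax _ (ID_subset_Icc n p) hB
      · right
        rw [hPA]
        refine ⟨A, hA, ?_⟩
        rw [ID_mul_revPerm]
        obtain ⟨m, -, rfl⟩ := hA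
        exact Finset.subset_sdiff.2
          ⟨ID_subset_Icc n m, Finset.disjoint_iff_inter_eq_empty.2 h⟩
      · left
        rw [hPA]
        exact ⟨A, hA, h⟩
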